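/- Let p be in the simplex Δ and suppose T ⊆ Y with |T| ≤ k minimizes the expected loss T' ↦ Σ_{y∈Y} p_y ℓ̂_4(T', y) over all subsets T' ⊆ Y with |T'| ≤ k. Then for every z ∈ T, p_z ≥ (1 − Σ_{i∈T} p_i)/(k + 1 − |T|). -/

import Mathlib

open scoped NNReal

def simplex (n : ℕ) : Set (Fin n → ℝ) := {p | (∀ i, 0 ≤ p i) ∧ ∑ i, p i = 1}

noncomputable def sigmaTop (n m : ℕ) (u : Fin n → ℝ) : ℝ :=
  if h : ((Finset.univ : Finset (Fin n)).powersetCard m).Nonempty then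
    ((Finset.univ : Finset (Fin n)).powersetCard m).sup' h (fun S => ∑ i ∈ S, u i)
  else 0

noncomputable def Lk (n k : ℕ) (u : Fin n → ℝ) (y : Fin n) : ℝ :=
  if h : (Finset.Icc 1 n).Nonempty then
    (Finset.Icc 1 n).sup' h
      (fun m => sigmaTop n m u / (m : ℝ) + max 0 (1 - (k : ℝ) / (m : ℝ))) - u y
  else 0

def indic {n : ℕ} (S : Finset (Fin n)) : Fin n → ℝ := fun i => if i ∈ S then 1 else 0

noncomputable def nthLarge {n : ℕ} (v : Fin n → ℝ) (j : ℕ) : ℝ :=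
  if h : n - j < n then v (Tuple.sort v ⟨n - j, h⟩) else 0

noncomputable def L2 (n k : ℕ) (u : Fin n → ℝ) (y : Fin n) : ℝ :=
  max 0 (1 - u y + (1 / (k : ℝ)) * sigmaTop n k (u - Pi.single y 1))

noncomputable def L3 (n k : ℕ) (u : Fin n → ℝ) (y : Fin n) : ℝ :=
  (1 / (k : ℝ)) * ∑ i ∈ Finset.Icc 1 k, max 0 (1 - u y + nthLarge (u - Pi.single y 1) i)

noncomputable def sigmaExcl (n k : ℕ) (u : Fin n → ℝ) (y : Fin n) : ℝ :=
  if h : ((Finset.univ.erase y).powersetCard k).Nonempty then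
    ((Finset.univ.erase y).powersetCard k).sup' h (fun S => ∑ i ∈ S, u i)
  else 0

noncomputable def L4 (n k : ℕ) (u : Fin n → ℝ) (y : Fin n) : ℝ :=
  max 0 (1 - u y + (1 / (k : ℝ)) * sigmaExcl n k u y)

noncomputable def ell2 (k : ℕ) {n : ℕ} (H M : Finset (Fin n)) (y : Fin n) : ℝ :=
  if y ∈ H then 0
  else if y ∈ M then ((H.card : ℝ) + M.card - 1) / ((k : ℝ) - H.card)
  else ((H.card : ℝ) + M.card - 1) / ((k : ℝ) - H.card) + ((k : ℝ) + 1) / k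

noncomputable def ell4 (k : ℕ) {n : ℕ} (T : Finset (Fin n)) (y : Fin n) : ℝ :=
  if y ∈ T then 0 else ((k : ℝ) + 1) / ((k : ℝ) + 1 - T.card)


theorem sum_mul_ell4 (k : ℕ) {n : ℕ} {p : Fin n → ℝ} (hp : ∑ i, p i = 1)
    (T : Finset (Fin n)) :
    ∑ y, p y * ell4 k T y =
      (1 - ∑ i ∈ T, p i) * (((k : ℝ) + 1) / ((k : ℝ) + 1 - T.card)) := by
  have hcompl : 1 - ∑ i ∈ T, p i = ∑ i ∈ Tᶜ, p i := by
    rw [sub_eq_iff_eq_add, Finset.sum_compl_add_sum, hp]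
  rw [hcompl, Finset.sum_mul, ← Finset.sum_compl_add_sum T, Finset.sum_eq_zero (s := T), add_zero]
  · refine Finset.sum_congr rfl fun y hy => ?_
    rw [ell4, if_neg (Finset.mem_compl.mp hy)]
  · intro y hy
    rw [ell4, if_pos hy, mul_zero]

theorem stmt18 (n k : ℕ) (hk : 1 ≤ k) (hkn : k < n)
    (p : Fin n → ℝ) (hp : p ∈ simplex n)
    (T : Finset (Fin n)) (hT : T.card ≤ k)
    (hmin : ∀ T' : Finset (Fin n), T'.card ≤ k →
      ∑ y, p y * ell4 k T y ≤ ∑ y, p y * ell4 k T' y) :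
    ∀ z ∈ T, (1 - ∑ i ∈ T, p i) / ((k : ℝ) + 1 - T.card) ≤ p z := by
  intro z hz
  have h := hmin (T.erase z) ((Finset.card_erase_le).trans hT)
  have hcard : ((T.erase z).card : ℝ) + 1 = T.card := by
    exact_mod_cast Finset.card_erase_add_one hz
  have hsum := Finset.sum_erase_add T p hz
  have hTk : (T.card : ℝ) ≤ k := by exact_mod_cast hT
  rw [sum_mul_ell4 k hp.2, sum_mul_ell4 k hp.2, ← mul_div_assoc, ← mul_div_assoc,
    div_le_div_iff₀ (by linarith) (by linarith)] at h
  rw [div_le_iff₀ (by linarith)]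
  have hk0 : (0 : ℝ) < k + 1 := by positivity
  refine le_of_mul_le_mul_right ?_ hk0
  rw [← eq_sub_iff_add_eq] at hcard hsum
  rw [hcard, hsum] at h
  linarith
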